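/- Let u and v be real nc functions with open domains D_u and D_v in the space of pairs of d-tuples of Hermitian matrices, assume u and v are Fréchet differentiable, and assume they satisfy the nc Cauchy–Riemann equations Du(A,B)(Z_1,Z_2) = Dv(A,B)(−Z_2,Z_1) for all (A,B) ∈ D := D_u ∩ D_v at every level n and all d-tuples Z_1, Z_2 of n×n Hermitian matrices. Define f on D_f := {A + iB : (A,B) ∈ D} by f(A+iB) := u(A,B) + i v(A,B). Then f is a Fréchet differentiable nc function: f is graded, respects direct sums, respects similarities (f(SXS^{-1}) = S f(X) S^{-1} for every invertible S with SXS^{-1} ∈ D_f), and is Fréchet differentiable at every point of D_f. -/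

import Mathlib

open Matrix Filter Topology

noncomputable section

/-- The `ℓ²`-operator norm of a rectangular complex matrix. -/
def opNorm {m n : ℕ} (M : Matrix (Fin m) (Fin n) ℂ) : ℝ :=
  ‖(Matrix.toEuclideanLin M).toContinuousLinearMap‖

/-- Direct sum (block diagonal) of two square complex matrices. -/
def dSum {n m : ℕ} (A : Matrix (Fin n) (Fin n) ℂ) (B : Matrix (Fin m) (Fin m) ℂ) :
    Matrix (Fin (n + m)) (Fin (n + m)) ℂ :=
  (Matrix.fromBlocks A 0 0 B).submatrix finSumFinEquiv.symm finSumFinEquiv.symm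

/-- Entrywise direct sum of two tuples of square complex matrices. -/
def dSumT {d n m : ℕ} (X : Fin d → Matrix (Fin n) (Fin n) ℂ)
    (Y : Fin d → Matrix (Fin m) (Fin m) ℂ) :
    Fin d → Matrix (Fin (n + m)) (Fin (n + m)) ℂ := fun k => dSum (X k) (Y k)

/-- The norm of a pair of tuples of matrices: the maximum of the operator norms of the
entries. -/
def pNorm {d n : ℕ} (Z1 Z2 : Fin d → Matrix (Fin n) (Fin n) ℂ) : ℝ :=
  ⨆ k, max (opNorm (Z1 k)) (opNorm (Z2 k))

/-- The norm of the complex tuple `Z₁ + iZ₂`: the maximum of the operator norms of the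
entries. -/
def cNorm {d n : ℕ} (Z1 Z2 : Fin d → Matrix (Fin n) (Fin n) ℂ) : ℝ :=
  ⨆ k, opNorm (Z1 k + Complex.I • Z2 k)

section Helpers

open scoped Matrix.Norms.L2Operator

theorem opNorm_eq {m n : ℕ} (M : Matrix (Fin m) (Fin n) ℂ) : opNorm M = ‖M‖ := rfl

def cT {d n : ℕ} (Z1 Z2 : Fin d → Matrix (Fin n) (Fin n) ℂ) : Fin d → Matrix (Fin n) (Fin n) ℂ :=
  fun k => Z1 k + Complex.I • Z2 k

theorem iSup_eq_pi_norm {d n : ℕ} (hd : 0 < d) (Z : Fin d → Matrix (Fin n) (Fin n) ℂ) :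
    (⨆ k, opNorm (Z k)) = ‖Z‖ := by
  have : Nonempty (Fin d) := ⟨⟨0, hd⟩⟩
  apply le_antisymm
  · exact ciSup_le fun k => by rw [opNorm_eq]; exact norm_le_pi_norm Z k
  · refine (pi_norm_le_iff_of_nonempty _).2 fun k => ?_
    exact le_ciSup (f := fun k => opNorm (Z k)) (Set.finite_range _).bddAbove k

theorem cNorm_eq {d n : ℕ} (hd : 0 < d) (Z1 Z2 : Fin d → Matrix (Fin n) (Fin n) ℂ) :
    cNorm Z1 Z2 = ‖cT Z1 Z2‖ := iSup_eq_pi_norm hd (cT Z1 Z2)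

def hRe {d n : ℕ} (X : Fin d → Matrix (Fin n) (Fin n) ℂ) : Fin d → Matrix (Fin n) (Fin n) ℂ :=
  fun k => (1 / 2 : ℂ) • (X k + (X k)ᴴ)

def hIm {d n : ℕ} (X : Fin d → Matrix (Fin n) (Fin n) ℂ) : Fin d → Matrix (Fin n) (Fin n) ℂ :=
  fun k => (-Complex.I / 2 : ℂ) • (X k - (X k)ᴴ)

theorem hRe_herm {d n : ℕ} (X : Fin d → Matrix (Fin n) (Fin n) ℂ) (k) :
    (hRe X k).IsHermitian := by
  simp [Matrix.IsHermitian, hRe, add_comm]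

theorem hIm_herm {d n : ℕ} (X : Fin d → Matrix (Fin n) (Fin n) ℂ) (k) :
    (hIm X k).IsHermitian := by
  simp only [Matrix.IsHermitian, hIm, Matrix.conjTranspose_smul, Matrix.conjTranspose_sub,
    Matrix.conjTranspose_conjTranspose]
  rw [← neg_sub (X k), smul_neg, ← neg_smul]
  congr 1
  simp [neg_div]

theorem cT_hRe_hIm {d n : ℕ} (X : Fin d → Matrix (Fin n) (Fin n) ℂ) :
    cT (hRe X) (hIm X) = X := by
  funext k
  simp only [cT, hRe, hIm, smul_smul]
  have : Complex.I * (-Complex.I / 2) = 1 / 2 := by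
    have := Complex.I_mul_I
    linear_combination (-1 / 2) * this
  rw [this, ← smul_add, add_add_sub_cancel, ← two_smul ℂ, smul_smul]
  norm_num

theorem hRe_cT {d n : ℕ} {Z1 Z2 : Fin d → Matrix (Fin n) (Fin n) ℂ}
    (h1 : ∀ k, (Z1 k).IsHermitian) (h2 : ∀ k, (Z2 k).IsHermitian) : hRe (cT Z1 Z2) = Z1 := by
  funext k
  simp only [cT, hRe, Matrix.conjTranspose_add, Matrix.conjTranspose_smul, (h1 k).eq, (h2 k).eq]
  ext i j
  simp
  ring

theorem hIm_cT {d n : ℕ} {Z1 Z2 : Fin d → Matrix (Fin n) (Fin n) ℂ}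
    (h1 : ∀ k, (Z1 k).IsHermitian) (h2 : ∀ k, (Z2 k).IsHermitian) : hIm (cT Z1 Z2) = Z2 := by
  funext k
  simp only [cT, hIm, Matrix.conjTranspose_add, Matrix.conjTranspose_smul, (h1 k).eq, (h2 k).eq]
  ext i j
  have := Complex.I_mul_I
  simp
  linear_combination (-Z2 k i j) * this

theorem norm_hRe_le {d n : ℕ} (X : Fin d → Matrix (Fin n) (Fin n) ℂ) (k) :
    ‖hRe X k‖ ≤ ‖X‖ := by
  have h := norm_le_pi_norm X k
  have h2 := norm_add_le (X k) (X k)ᴴ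
  rw [Matrix.l2_opNorm_conjTranspose] at h2
  rw [hRe, norm_smul]
  norm_num
  linarith

theorem norm_hIm_le {d n : ℕ} (X : Fin d → Matrix (Fin n) (Fin n) ℂ) (k) :
    ‖hIm X k‖ ≤ ‖X‖ := by
  have h := norm_le_pi_norm X k
  have h2 := norm_sub_le (X k) (X k)ᴴ
  rw [Matrix.l2_opNorm_conjTranspose] at h2
  rw [hIm, norm_smul]
  norm_num
  linarith

theorem pNorm_le {d n : ℕ} (hd : 0 < d) {Z1 Z2 : Fin d → Matrix (Fin n) (Fin n) ℂ}
    (h1 : ∀ k, (Z1 k).IsHermitian) (h2 : ∀ k, (Z2 k).IsHermitian) :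
    pNorm Z1 Z2 ≤ ‖cT Z1 Z2‖ := by
  have : Nonempty (Fin d) := ⟨⟨0, hd⟩⟩
  refine ciSup_le fun k => max_le ?_ ?_
  · have := norm_hRe_le (cT Z1 Z2) k
    rwa [hRe_cT h1 h2] at this
  · have := norm_hIm_le (cT Z1 Z2) k
    rwa [hIm_cT h1 h2] at this

theorem pNorm_pos {d n : ℕ} {Z1 Z2 : Fin d → Matrix (Fin n) (Fin n) ℂ}
    (h : ¬(Z1 = 0 ∧ Z2 = 0)) : 0 < pNorm Z1 Z2 := by
  have hle : ∀ k, max (opNorm (Z1 k)) (opNorm (Z2 k)) ≤ pNorm Z1 Z2 := fun k =>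
    le_ciSup (f := fun k => max (opNorm (Z1 k)) (opNorm (Z2 k))) (Set.finite_range _).bddAbove k
  by_contra hn
  apply h
  constructor <;> funext k <;> apply norm_le_zero_iff.1
  · exact ((le_max_left _ _).trans (hle k)).trans (not_lt.1 hn)
  · exact ((le_max_right _ _).trans (hle k)).trans (not_lt.1 hn)

theorem frechet_aux {d n : ℕ} (hd : 0 < d)
    (g Dg : ((Fin d → Matrix (Fin n) (Fin n) ℂ) × (Fin d → Matrix (Fin n) (Fin n) ℂ)) →
      Matrix (Fin n) (Fin n) ℂ) (P)
    (h0 : Dg (0, 0) = 0)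
    (h : ∀ ε > (0 : ℝ), ∃ δ > (0 : ℝ),
      ∀ Z1 Z2 : Fin d → Matrix (Fin n) (Fin n) ℂ,
        (∀ k, (Z1 k).IsHermitian) → (∀ k, (Z2 k).IsHermitian) →
        ¬(Z1 = 0 ∧ Z2 = 0) → pNorm Z1 Z2 < δ →
        opNorm (g (P + (Z1, Z2)) - g P - Dg (Z1, Z2)) / pNorm Z1 Z2 < ε)
    (ε : ℝ) (hε : 0 < ε) : ∃ δ > (0 : ℝ),
      ∀ Z1 Z2 : Fin d → Matrix (Fin n) (Fin n) ℂ,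
        (∀ k, (Z1 k).IsHermitian) → (∀ k, (Z2 k).IsHermitian) → ‖cT Z1 Z2‖ < δ →
        ‖g (P + (Z1, Z2)) - g P - Dg (Z1, Z2)‖ ≤ ε * ‖cT Z1 Z2‖ := by
  obtain ⟨δ, hδ, H⟩ := h ε hε
  refine ⟨δ, hδ, fun Z1 Z2 h1 h2 hZ => ?_⟩
  by_cases hz : Z1 = 0 ∧ Z2 = 0
  · obtain ⟨rfl, rfl⟩ := hz
    have : (P + (0, 0)) = P := add_zero P
    rw [this, h0]
    simp only [sub_self, norm_zero]
    positivity
  · have hp := pNorm_pos hz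
    have hle := pNorm_le hd h1 h2
    have := H Z1 Z2 h1 h2 hz (hle.trans_lt hZ)
    rw [div_lt_iff₀ hp] at this
    exact this.le.trans (mul_le_mul_of_nonneg_left hle hε.le)

theorem level_deriv {d n : ℕ} (hd : 0 < d)
    (u v Du Dv : ((Fin d → Matrix (Fin n) (Fin n) ℂ) × (Fin d → Matrix (Fin n) (Fin n) ℂ)) →
      Matrix (Fin n) (Fin n) ℂ) (P)
    (hDuadd : ∀ Z1 Z2 W1 W2 : Fin d → Matrix (Fin n) (Fin n) ℂ,
      (∀ k, (Z1 k).IsHermitian) → (∀ k, (Z2 k).IsHermitian) →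
      (∀ k, (W1 k).IsHermitian) → (∀ k, (W2 k).IsHermitian) →
      Du (Z1 + W1, Z2 + W2) = Du (Z1, Z2) + Du (W1, W2))
    (hDusmul : ∀ (t : ℝ) (Z1 Z2 : Fin d → Matrix (Fin n) (Fin n) ℂ),
      (∀ k, (Z1 k).IsHermitian) → (∀ k, (Z2 k).IsHermitian) →
      Du (t • Z1, t • Z2) = t • Du (Z1, Z2))
    (hDuF : ∀ ε > (0 : ℝ), ∃ δ > (0 : ℝ),
      ∀ Z1 Z2 : Fin d → Matrix (Fin n) (Fin n) ℂ,
        (∀ k, (Z1 k).IsHermitian) → (∀ k, (Z2 k).IsHermitian) →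
        ¬(Z1 = 0 ∧ Z2 = 0) → pNorm Z1 Z2 < δ →
        opNorm (u (P + (Z1, Z2)) - u P - Du (Z1, Z2)) / pNorm Z1 Z2 < ε)
    (hDvadd : ∀ Z1 Z2 W1 W2 : Fin d → Matrix (Fin n) (Fin n) ℂ,
      (∀ k, (Z1 k).IsHermitian) → (∀ k, (Z2 k).IsHermitian) →
      (∀ k, (W1 k).IsHermitian) → (∀ k, (W2 k).IsHermitian) →
      Dv (Z1 + W1, Z2 + W2) = Dv (Z1, Z2) + Dv (W1, W2))
    (hDvsmul : ∀ (t : ℝ) (Z1 Z2 : Fin d → Matrix (Fin n) (Fin n) ℂ),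
      (∀ k, (Z1 k).IsHermitian) → (∀ k, (Z2 k).IsHermitian) →
      Dv (t • Z1, t • Z2) = t • Dv (Z1, Z2))
    (hDvF : ∀ ε > (0 : ℝ), ∃ δ > (0 : ℝ),
      ∀ Z1 Z2 : Fin d → Matrix (Fin n) (Fin n) ℂ,
        (∀ k, (Z1 k).IsHermitian) → (∀ k, (Z2 k).IsHermitian) →
        ¬(Z1 = 0 ∧ Z2 = 0) → pNorm Z1 Z2 < δ →
        opNorm (v (P + (Z1, Z2)) - v P - Dv (Z1, Z2)) / pNorm Z1 Z2 < ε)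
    (hCR : ∀ Z1 Z2 : Fin d → Matrix (Fin n) (Fin n) ℂ,
        (∀ k, (Z1 k).IsHermitian) → (∀ k, (Z2 k).IsHermitian) →
        Du (Z1, Z2) = Dv (-Z2, Z1)) :
    ∃ L : (Fin d → Matrix (Fin n) (Fin n) ℂ) →ₗ[ℂ] Matrix (Fin n) (Fin n) ℂ,
      ∀ ε > (0 : ℝ), ∃ δ > (0 : ℝ), ∀ W : Fin d → Matrix (Fin n) (Fin n) ℂ, ‖W‖ < δ →
        ‖(u (P + (hRe W, hIm W)) + Complex.I • v (P + (hRe W, hIm W))) -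
          (u P + Complex.I • v P) - L W‖ ≤ ε * ‖W‖ := by
  have hneg : ∀ Z : Fin d → Matrix (Fin n) (Fin n) ℂ, (∀ k, (Z k).IsHermitian) →
      ∀ k, ((-Z) k).IsHermitian := fun Z h k => (h k).neg
  have hsm : ∀ (t : ℝ) (Z : Fin d → Matrix (Fin n) (Fin n) ℂ), (∀ k, (Z k).IsHermitian) →
      ∀ k, ((t • Z) k).IsHermitian := fun t Z h k => by
    have := (h k).eq
    simp [Matrix.IsHermitian, this]
  have h00 : ∀ k : Fin d, ((0 : Fin d → Matrix (Fin n) (Fin n) ℂ) k).IsHermitian := fun k =>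
    Matrix.isHermitian_zero
  have hu0 : Du (0, 0) = 0 := by simpa using hDusmul 0 0 0 h00 h00
  have hv0 : Dv (0, 0) = 0 := by simpa using hDvsmul 0 0 0 h00 h00
  let l : (Fin d → Matrix (Fin n) (Fin n) ℂ) → Matrix (Fin n) (Fin n) ℂ :=
    fun X => Du (hRe X, hIm X) + Complex.I • Dv (hRe X, hIm X)
  have ladd : ∀ X Y, l (X + Y) = l X + l Y := by
    intro X Y
    have e1 : hRe (X + Y) = hRe X + hRe Y := by
      funext k; simp only [hRe, Pi.add_apply, Matrix.conjTranspose_add, ← smul_add]; congr 1; abel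
    have e2 : hIm (X + Y) = hIm X + hIm Y := by
      funext k; simp only [hIm, Pi.add_apply, Matrix.conjTranspose_add, ← smul_add]; congr 1; abel
    simp only [l, e1, e2]
    rw [hDuadd _ _ _ _ (hRe_herm X) (hIm_herm X) (hRe_herm Y) (hIm_herm Y),
      hDvadd _ _ _ _ (hRe_herm X) (hIm_herm X) (hRe_herm Y) (hIm_herm Y), smul_add]
    abel
  have lsm : ∀ (t : ℝ) X, l ((t : ℂ) • X) = (t : ℂ) • l X := by
    intro t X
    have e1 : hRe ((t : ℂ) • X) = t • hRe X := by
      funext k; ext i j; simp [hRe]; ring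
    have e2 : hIm ((t : ℂ) • X) = t • hIm X := by
      funext k; ext i j; simp [hIm]; ring
    simp only [l, e1, e2]
    rw [hDusmul _ _ _ (hRe_herm X) (hIm_herm X), hDvsmul _ _ _ (hRe_herm X) (hIm_herm X)]
    ext i j; simp; ring
  have lI : ∀ X, l (Complex.I • X) = Complex.I • l X := by
    intro X
    have e1 : hRe (Complex.I • X) = - hIm X := by
      funext k; ext i j; simp [hRe, hIm]; ring
    have e2 : hIm (Complex.I • X) = hRe X := by
      funext k; ext i j; simp [hRe, hIm]; 
      linear_combination (-1 / 2) * (X k i j + (starRingEnd ℂ) (X k j i)) * Complex.I_mul_I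
    simp only [l, e1, e2]
    rw [← hCR _ _ (hRe_herm X) (hIm_herm X), hCR _ _ (hneg _ (hIm_herm X)) (hRe_herm X)]
    have := hDvsmul (-1) _ _ (hRe_herm X) (hIm_herm X)
    simp only [neg_smul, one_smul] at this
    rw [this, smul_add, smul_smul, Complex.I_mul_I]
    simp [add_comm]
  let L : (Fin d → Matrix (Fin n) (Fin n) ℂ) →ₗ[ℂ] Matrix (Fin n) (Fin n) ℂ :=
    { toFun := l
      map_add' := ladd
      map_smul' := by
        intro c X
        have hc : c • X = (c.re : ℂ) • X + (c.im : ℂ) • (Complex.I • X) := by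
          rw [smul_smul, ← add_smul, Complex.re_add_im]
        rw [hc, ladd, lsm, lsm, lI, smul_smul, ← add_smul, Complex.re_add_im]
        rfl }
  refine ⟨L, fun ε hε => ?_⟩
  obtain ⟨δ1, hδ1, H1⟩ := frechet_aux hd u Du P hu0 hDuF (ε / 2) (by positivity)
  obtain ⟨δ2, hδ2, H2⟩ := frechet_aux hd v Dv P hv0 hDvF (ε / 2) (by positivity)
  refine ⟨min δ1 δ2, lt_min hδ1 hδ2, fun W hW => ?_⟩
  have a1 := H1 _ _ (hRe_herm W) (hIm_herm W)
    (by rw [cT_hRe_hIm]; exact hW.trans_le (min_le_left _ _))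
  have a2 := H2 _ _ (hRe_herm W) (hIm_herm W)
    (by rw [cT_hRe_hIm]; exact hW.trans_le (min_le_right _ _))
  rw [cT_hRe_hIm] at a1 a2
  have e : (u (P + (hRe W, hIm W)) + Complex.I • v (P + (hRe W, hIm W))) -
          (u P + Complex.I • v P) - L W =
      (u (P + (hRe W, hIm W)) - u P - Du (hRe W, hIm W)) +
      Complex.I • (v (P + (hRe W, hIm W)) - v P - Dv (hRe W, hIm W)) := by
    change _ - _ - (Du (hRe W, hIm W) + Complex.I • Dv (hRe W, hIm W)) = _
    rw [smul_sub, smul_sub]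
    abel
  rw [e]
  refine (norm_add_le _ _).trans ?_
  rw [norm_smul, Complex.norm_I, one_mul]
  linarith

theorem comm_skew {d n : ℕ}
    (u v : ((Fin d → Matrix (Fin n) (Fin n) ℂ) × (Fin d → Matrix (Fin n) (Fin n) ℂ)) →
      Matrix (Fin n) (Fin n) ℂ) (P)
    (hP1 : ∀ k, (Prod.fst P k).IsHermitian) (hP2 : ∀ k, (Prod.snd P k).IsHermitian)
    (L : (Fin d → Matrix (Fin n) (Fin n) ℂ) →ₗ[ℂ] Matrix (Fin n) (Fin n) ℂ)
    (hL : ∀ ε > (0 : ℝ), ∃ δ > (0 : ℝ), ∀ W : Fin d → Matrix (Fin n) (Fin n) ℂ, ‖W‖ < δ →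
        ‖(u (P + (hRe W, hIm W)) + Complex.I • v (P + (hRe W, hIm W))) -
          (u P + Complex.I • v P) - L W‖ ≤ ε * ‖W‖)
    (hU : ∃ ε > (0 : ℝ), ∀ U : Matrix (Fin n) (Fin n) ℂ, U ∈ Matrix.unitaryGroup (Fin n) ℂ →
      (∀ k, ‖U * Prod.fst P k * star U - Prod.fst P k‖ < ε) →
      (∀ k, ‖U * Prod.snd P k * star U - Prod.snd P k‖ < ε) →
      u ((fun k => U * Prod.fst P k * star U), (fun k => U * Prod.snd P k * star U)) +
      Complex.I • v ((fun k => U * Prod.fst P k * star U), (fun k => U * Prod.snd P k * star U)) =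
        U * (u P + Complex.I • v P) * star U)
    (K : Matrix (Fin n) (Fin n) ℂ) (hK : star K = -K) :
    L (fun k => K * (cT P.1 P.2) k - (cT P.1 P.2) k * K) =
      K * (u P + Complex.I • v P) - (u P + Complex.I • v P) * K := by
  set X := cT P.1 P.2 with hX
  set c := u P + Complex.I • v P with hc
  let F : (Fin d → Matrix (Fin n) (Fin n) ℂ) → Matrix (Fin n) (Fin n) ℂ := fun W =>
    u (P + (hRe W, hIm W)) + Complex.I • v (P + (hRe W, hIm W))
  have hz1 : hRe (0 : Fin d → Matrix (Fin n) (Fin n) ℂ) = 0 := by funext k; simp [hRe]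
  have hz2 : hIm (0 : Fin d → Matrix (Fin n) (Fin n) ℂ) = 0 := by funext k; simp [hIm]
  have hF0 : F 0 = c := by
    have : (P + (0, 0)) = P := add_zero P
    simp only [F, hz1, hz2, this, c]
  have hF : HasFDerivAt F ((L.restrictScalars ℝ).toContinuousLinearMap) 0 := by
    apply HasFDerivAt.of_isLittleO
    rw [Asymptotics.isLittleO_iff]
    intro ε hε
    obtain ⟨δ, hδ, H⟩ := hL ε hε
    filter_upwards [Metric.ball_mem_nhds 0 hδ] with W hW
    rw [hF0, sub_zero]
    exact H W (by simpa using hW)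
  have hconj : ∀ M : Matrix (Fin n) (Fin n) ℂ,
      HasDerivAt (fun t : ℝ => NormedSpace.exp (t • K) * M * NormedSpace.exp (t • (-K)))
        (K * M - M * K) 0 := by
    intro M
    have h1 : HasDerivAt (fun t : ℝ => NormedSpace.exp (t • K)) K 0 := by
      simpa using hasDerivAt_exp_smul_const (𝕂 := ℝ) K 0
    have h2 : HasDerivAt (fun t : ℝ => NormedSpace.exp (t • (-K))) (-K) 0 := by
      simpa using hasDerivAt_exp_smul_const (𝕂 := ℝ) (-K) 0
    have h3 := (h1.mul_const M).mul h2
    have e : K * M * NormedSpace.exp ((0 : ℝ) • (-K)) + NormedSpace.exp ((0 : ℝ) • K) * M * (-K) =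
        K * M - M * K := by
      rw [zero_smul, zero_smul, NormedSpace.exp_zero]
      noncomm_ring
    rw [← e]
    exact h3
  have hstar : ∀ t : ℝ, NormedSpace.exp (t • (-K)) = star (NormedSpace.exp (t • K)) := by
    intro t
    rw [NormedSpace.star_exp, star_smul, hK]
    simp
  have huni : ∀ t : ℝ, NormedSpace.exp (t • K) ∈ Matrix.unitaryGroup (Fin n) ℂ := by
    intro t
    letI : NormedAlgebra ℚ (Matrix (Fin n) (Fin n) ℂ) := NormedAlgebra.restrictScalars ℚ ℂ _
    apply NormedSpace.exp_mem_unitary_of_mem_skewAdjoint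
    rw [skewAdjoint.mem_iff, star_smul, hK]
    simp
  let w : ℝ → (Fin d → Matrix (Fin n) (Fin n) ℂ) := fun t k =>
    NormedSpace.exp (t • K) * X k * NormedSpace.exp (t • (-K)) - X k
  have hw : HasDerivAt w (fun k => K * X k - X k * K) 0 := by
    rw [hasDerivAt_pi]
    intro k
    exact (hconj (X k)).sub_const _
  have hw0 : w 0 = 0 := by funext k; simp [w]
  have hcomp : HasDerivAt (fun t => F (w t)) (L (fun k => K * X k - X k * K)) 0 := by
    have hF' : HasFDerivAt F ((L.restrictScalars ℝ).toContinuousLinearMap) (w 0) := by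
      rw [hw0]; exact hF
    exact hF'.comp_hasDerivAt 0 hw
  have hev : (fun t => F (w t)) =ᶠ[𝓝 (0 : ℝ)]
      (fun t : ℝ => NormedSpace.exp (t • K) * c * NormedSpace.exp (t • (-K))) := by
    obtain ⟨ε, hε, H⟩ := hU
    have hcont : ∀ M : Matrix (Fin n) (Fin n) ℂ, ∀ᶠ t : ℝ in 𝓝 0,
        ‖NormedSpace.exp (t • K) * M * NormedSpace.exp (t • (-K)) - M‖ < ε := by
      intro M
      have := ((hconj M).continuousAt).eventually (Metric.ball_mem_nhds _ hε)
      simpa [dist_eq_norm] using this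
    have e1 : ∀ᶠ t : ℝ in 𝓝 0, ∀ k, 
        ‖NormedSpace.exp (t • K) * P.1 k * NormedSpace.exp (t • (-K)) - P.1 k‖ < ε :=
      eventually_all.2 fun k => hcont _
    have e2 : ∀ᶠ t : ℝ in 𝓝 0, ∀ k, 
        ‖NormedSpace.exp (t • K) * P.2 k * NormedSpace.exp (t • (-K)) - P.2 k‖ < ε :=
      eventually_all.2 fun k => hcont _
    filter_upwards [e1, e2] with t ht1 ht2
    simp only [hstar] at ht1 ht2 ⊢
    rw [← H _ (huni t) ht1 ht2]
    have hh : ∀ M : Matrix (Fin n) (Fin n) ℂ, M.IsHermitian →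
        (NormedSpace.exp (t • K) * M * star (NormedSpace.exp (t • K)) - M).IsHermitian := by
      intro M hM
      exact (Matrix.isHermitian_mul_mul_conjTranspose _ hM).sub hM
    have hwt : w t = cT
        (fun k => NormedSpace.exp (t • K) * P.1 k * star (NormedSpace.exp (t • K)) - P.1 k)
        (fun k => NormedSpace.exp (t • K) * P.2 k * star (NormedSpace.exp (t • K)) - P.2 k) := by
      funext k
      simp only [w, X, cT, hstar, mul_add, add_mul, smul_sub, Matrix.mul_smul, Matrix.smul_mul]
      abel
    have hPw : P + (hRe (w t), hIm (w t)) = 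
        ((fun k => NormedSpace.exp (t • K) * P.1 k * star (NormedSpace.exp (t • K))),
        (fun k => NormedSpace.exp (t • K) * P.2 k * star (NormedSpace.exp (t • K)))) := by
      rw [hwt, hRe_cT (fun k => hh _ (hP1 k)) (fun k => hh _ (hP2 k)),
        hIm_cT (fun k => hh _ (hP1 k)) (fun k => hh _ (hP2 k))]
      refine Prod.ext ?_ ?_ <;> funext k <;> simp
    simp only [F, hPw]
  exact hcomp.unique ((hconj c).congr_of_eventuallyEq hev)

theorem comm_all {d n : ℕ} (L : (Fin d → Matrix (Fin n) (Fin n) ℂ) →ₗ[ℂ] Matrix (Fin n) (Fin n) ℂ)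
    (X : Fin d → Matrix (Fin n) (Fin n) ℂ) (c : Matrix (Fin n) (Fin n) ℂ)
    (h : ∀ K : Matrix (Fin n) (Fin n) ℂ, star K = -K →
      L (fun k => K * X k - X k * K) = K * c - c * K)
    (K : Matrix (Fin n) (Fin n) ℂ) : L (fun k => K * X k - X k * K) = K * c - c * K := by
  have h1 := h (K - star K) (by simp)
  have h2 := h (Complex.I • (K + star K)) (by simp [add_comm])
  have e : (fun k => K * X k - X k * K) =
      (1 / 2 : ℂ) • (fun k => (K - star K) * X k - X k * (K - star K)) +
      (-Complex.I / 2) • (fun k => (Complex.I • (K + star K)) * X k -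
        X k * (Complex.I • (K + star K))) := by
    have hI : (-Complex.I / 2) * Complex.I = 1 / 2 := by
      linear_combination (-1 / 2) * Complex.I_mul_I
    funext k
    simp only [Pi.add_apply, Pi.smul_apply, Matrix.mul_smul, Matrix.smul_mul, ← smul_sub,
      smul_smul, hI]
    rw [← smul_add]
    have : (K - star K) * X k - X k * (K - star K) +
        ((K + star K) * X k - X k * (K + star K)) = (2 : ℂ) • (K * X k - X k * K) := by
      rw [two_smul]; noncomm_ring
    rw [this, smul_smul]; norm_num
  rw [e, map_add, map_smul, map_smul, h1, h2]
  have hI : (-Complex.I / 2) * Complex.I = 1 / 2 := by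
    linear_combination (-1 / 2) * Complex.I_mul_I
  simp only [Matrix.mul_smul, Matrix.smul_mul, ← smul_sub, smul_smul, hI]
  rw [← smul_add]
  have : (K - star K) * c - c * (K - star K) +
      ((K + star K) * c - c * (K + star K)) = (2 : ℂ) • (K * c - c * K) := by
    rw [two_smul]; noncomm_ring
  rw [this, smul_smul]; norm_num

theorem dSum_add_smul {n m : ℕ} (A A' : Matrix (Fin n) (Fin n) ℂ) (B B' : Matrix (Fin m) (Fin m) ℂ) :
    dSum A B + Complex.I • dSum A' B' = dSum (A + Complex.I • A') (B + Complex.I • B') := by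
  have : Matrix.fromBlocks (A + Complex.I • A') 0 0 (B + Complex.I • B') =
      Matrix.fromBlocks A 0 0 B + Complex.I • Matrix.fromBlocks A' 0 0 B' := by
    rw [Matrix.fromBlocks_smul, Matrix.fromBlocks_add]; simp
  rw [dSum, dSum, dSum, this]
  rfl

theorem low_comm {n : ℕ} (S A B : Matrix (Fin n) (Fin n) ℂ) :
    (Matrix.fromBlocks 0 0 S 0).submatrix finSumFinEquiv.symm finSumFinEquiv.symm * dSum A B -
      dSum A B * (Matrix.fromBlocks 0 0 S 0).submatrix finSumFinEquiv.symm finSumFinEquiv.symm =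
    (Matrix.fromBlocks 0 0 (S * A - B * S) 0).submatrix finSumFinEquiv.symm
      (finSumFinEquiv (m := n) (n := n)).symm := by
  rw [dSum, Matrix.submatrix_mul_equiv, Matrix.submatrix_mul_equiv, Matrix.fromBlocks_multiply,
    Matrix.fromBlocks_multiply]
  have : Matrix.fromBlocks 0 0 (S * A - B * S) 0 =
    Matrix.fromBlocks 0 0 (S * A) 0 - Matrix.fromBlocks (0 : Matrix (Fin n) (Fin n) ℂ) 0 (B * S)
      (0 : Matrix (Fin n) (Fin n) ℂ) := by
    ext i j; rcases i with i | i <;> rcases j with j | j <;> simp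
  rw [this]
  simp
  rfl

end Helpers

/-- (Theorem 1.2 of the paper.) If `u`, `v` are Fréchet differentiable real
nc functions with open domains satisfying the nc Cauchy–Riemann equations, then
`f = u + iv` is a Fréchet differentiable nc function: it is graded, respects direct sums,
respects similarities, and is Fréchet differentiable at every point of its domain. -/
theorem cauchy_riemann_sufficiency (d : ℕ) (hd : 0 < d)
    (Du_dom : ∀ n : ℕ, Set ((Fin d → Matrix (Fin n) (Fin n) ℂ) ×
      (Fin d → Matrix (Fin n) (Fin n) ℂ)))
    (hDu_domherm : ∀ n, ∀ P ∈ Du_dom n,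
      (∀ k, (Prod.fst P k).IsHermitian) ∧ (∀ k, (Prod.snd P k).IsHermitian))
    (hDu_domsum : ∀ n m, ∀ P ∈ Du_dom n, ∀ Q ∈ Du_dom m,
      (dSumT (Prod.fst P) (Prod.fst Q), dSumT (Prod.snd P) (Prod.snd Q)) ∈ Du_dom (n + m))
    (u : ∀ n : ℕ, ((Fin d → Matrix (Fin n) (Fin n) ℂ) ×
      (Fin d → Matrix (Fin n) (Fin n) ℂ)) → Matrix (Fin n) (Fin n) ℂ)
    (huherm : ∀ n, ∀ P ∈ Du_dom n, (u n P).IsHermitian)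
    (husum : ∀ n m, ∀ P ∈ Du_dom n, ∀ Q ∈ Du_dom m,
      u (n + m) (dSumT (Prod.fst P) (Prod.fst Q), dSumT (Prod.snd P) (Prod.snd Q)) =
        dSum (u n P) (u m Q))
    (huu : ∀ n, ∀ P ∈ Du_dom n, ∀ U : Matrix (Fin n) (Fin n) ℂ,
      U ∈ Matrix.unitaryGroup (Fin n) ℂ →
      ((fun k => U * Prod.fst P k * star U), (fun k => U * Prod.snd P k * star U)) ∈ Du_dom n →
      u n ((fun k => U * Prod.fst P k * star U), (fun k => U * Prod.snd P k * star U)) =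
        U * u n P * star U)
    (hDu_domopen : ∀ n, ∀ P ∈ Du_dom n, ∃ ε > (0 : ℝ),
      ∀ Q : (Fin d → Matrix (Fin n) (Fin n) ℂ) × (Fin d → Matrix (Fin n) (Fin n) ℂ),
        (∀ k, (Prod.fst Q k).IsHermitian) → (∀ k, (Prod.snd Q k).IsHermitian) →
        (∀ k, opNorm (Prod.fst Q k - Prod.fst P k) < ε) →
        (∀ k, opNorm (Prod.snd Q k - Prod.snd P k) < ε) → Q ∈ Du_dom n)
    (Dv_dom : ∀ n : ℕ, Set ((Fin d → Matrix (Fin n) (Fin n) ℂ) ×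
      (Fin d → Matrix (Fin n) (Fin n) ℂ)))
    (hDv_domherm : ∀ n, ∀ P ∈ Dv_dom n,
      (∀ k, (Prod.fst P k).IsHermitian) ∧ (∀ k, (Prod.snd P k).IsHermitian))
    (hDv_domsum : ∀ n m, ∀ P ∈ Dv_dom n, ∀ Q ∈ Dv_dom m,
      (dSumT (Prod.fst P) (Prod.fst Q), dSumT (Prod.snd P) (Prod.snd Q)) ∈ Dv_dom (n + m))
    (v : ∀ n : ℕ, ((Fin d → Matrix (Fin n) (Fin n) ℂ) ×
      (Fin d → Matrix (Fin n) (Fin n) ℂ)) → Matrix (Fin n) (Fin n) ℂ)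
    (hvherm : ∀ n, ∀ P ∈ Dv_dom n, (v n P).IsHermitian)
    (hvsum : ∀ n m, ∀ P ∈ Dv_dom n, ∀ Q ∈ Dv_dom m,
      v (n + m) (dSumT (Prod.fst P) (Prod.fst Q), dSumT (Prod.snd P) (Prod.snd Q)) =
        dSum (v n P) (v m Q))
    (hvu : ∀ n, ∀ P ∈ Dv_dom n, ∀ U : Matrix (Fin n) (Fin n) ℂ,
      U ∈ Matrix.unitaryGroup (Fin n) ℂ →
      ((fun k => U * Prod.fst P k * star U), (fun k => U * Prod.snd P k * star U)) ∈ Dv_dom n →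
      v n ((fun k => U * Prod.fst P k * star U), (fun k => U * Prod.snd P k * star U)) =
        U * v n P * star U)
    (hDv_domopen : ∀ n, ∀ P ∈ Dv_dom n, ∃ ε > (0 : ℝ),
      ∀ Q : (Fin d → Matrix (Fin n) (Fin n) ℂ) × (Fin d → Matrix (Fin n) (Fin n) ℂ),
        (∀ k, (Prod.fst Q k).IsHermitian) → (∀ k, (Prod.snd Q k).IsHermitian) →
        (∀ k, opNorm (Prod.fst Q k - Prod.fst P k) < ε) →
        (∀ k, opNorm (Prod.snd Q k - Prod.snd P k) < ε) → Q ∈ Dv_dom n)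
    (Du : ∀ n : ℕ, ((Fin d → Matrix (Fin n) (Fin n) ℂ) ×
        (Fin d → Matrix (Fin n) (Fin n) ℂ)) →
      ((Fin d → Matrix (Fin n) (Fin n) ℂ) × (Fin d → Matrix (Fin n) (Fin n) ℂ)) →
      Matrix (Fin n) (Fin n) ℂ)
    (hDuadd : ∀ n, ∀ P ∈ Du_dom n, ∀ Z1 Z2 W1 W2 : Fin d → Matrix (Fin n) (Fin n) ℂ,
      (∀ k, (Z1 k).IsHermitian) → (∀ k, (Z2 k).IsHermitian) →
      (∀ k, (W1 k).IsHermitian) → (∀ k, (W2 k).IsHermitian) →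
      Du n P (Z1 + W1, Z2 + W2) = Du n P (Z1, Z2) + Du n P (W1, W2))
    (hDusmul : ∀ n, ∀ P ∈ Du_dom n, ∀ (t : ℝ) (Z1 Z2 : Fin d → Matrix (Fin n) (Fin n) ℂ),
      (∀ k, (Z1 k).IsHermitian) → (∀ k, (Z2 k).IsHermitian) →
      Du n P (t • Z1, t • Z2) = t • Du n P (Z1, Z2))
    (hDuF : ∀ n, ∀ P ∈ Du_dom n, ∀ ε > (0 : ℝ), ∃ δ > (0 : ℝ),
      ∀ Z1 Z2 : Fin d → Matrix (Fin n) (Fin n) ℂ,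
        (∀ k, (Z1 k).IsHermitian) → (∀ k, (Z2 k).IsHermitian) →
        ¬(Z1 = 0 ∧ Z2 = 0) → pNorm Z1 Z2 < δ →
        opNorm (u n (P + (Z1, Z2)) - u n P - Du n P (Z1, Z2)) / pNorm Z1 Z2 < ε)
    (Dv : ∀ n : ℕ, ((Fin d → Matrix (Fin n) (Fin n) ℂ) ×
        (Fin d → Matrix (Fin n) (Fin n) ℂ)) →
      ((Fin d → Matrix (Fin n) (Fin n) ℂ) × (Fin d → Matrix (Fin n) (Fin n) ℂ)) →
      Matrix (Fin n) (Fin n) ℂ)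
    (hDvadd : ∀ n, ∀ P ∈ Dv_dom n, ∀ Z1 Z2 W1 W2 : Fin d → Matrix (Fin n) (Fin n) ℂ,
      (∀ k, (Z1 k).IsHermitian) → (∀ k, (Z2 k).IsHermitian) →
      (∀ k, (W1 k).IsHermitian) → (∀ k, (W2 k).IsHermitian) →
      Dv n P (Z1 + W1, Z2 + W2) = Dv n P (Z1, Z2) + Dv n P (W1, W2))
    (hDvsmul : ∀ n, ∀ P ∈ Dv_dom n, ∀ (t : ℝ) (Z1 Z2 : Fin d → Matrix (Fin n) (Fin n) ℂ),
      (∀ k, (Z1 k).IsHermitian) → (∀ k, (Z2 k).IsHermitian) →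
      Dv n P (t • Z1, t • Z2) = t • Dv n P (Z1, Z2))
    (hDvF : ∀ n, ∀ P ∈ Dv_dom n, ∀ ε > (0 : ℝ), ∃ δ > (0 : ℝ),
      ∀ Z1 Z2 : Fin d → Matrix (Fin n) (Fin n) ℂ,
        (∀ k, (Z1 k).IsHermitian) → (∀ k, (Z2 k).IsHermitian) →
        ¬(Z1 = 0 ∧ Z2 = 0) → pNorm Z1 Z2 < δ →
        opNorm (v n (P + (Z1, Z2)) - v n P - Dv n P (Z1, Z2)) / pNorm Z1 Z2 < ε)
    (hCR : ∀ n, ∀ P, P ∈ Du_dom n → P ∈ Dv_dom n →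
      ∀ Z1 Z2 : Fin d → Matrix (Fin n) (Fin n) ℂ,
        (∀ k, (Z1 k).IsHermitian) → (∀ k, (Z2 k).IsHermitian) →
        Du n P (Z1, Z2) = Dv n P (-Z2, Z1)) :
    -- `f` respects direct sums:
    (∀ n m, ∀ P, P ∈ Du_dom n → P ∈ Dv_dom n → ∀ Q, Q ∈ Du_dom m → Q ∈ Dv_dom m →
      u (n + m) (dSumT (Prod.fst P) (Prod.fst Q), dSumT (Prod.snd P) (Prod.snd Q)) +
          Complex.I • v (n + m)
            (dSumT (Prod.fst P) (Prod.fst Q), dSumT (Prod.snd P) (Prod.snd Q)) =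
        dSum (u n P + Complex.I • v n P) (u m Q + Complex.I • v m Q)) ∧
    -- `f` respects similarities: if `S (A+iB) S⁻¹ = C+iD` is again a point of the domain,
    -- then `f(S X S⁻¹) = S f(X) S⁻¹`:
    (∀ n, ∀ P, P ∈ Du_dom n → P ∈ Dv_dom n → ∀ S : Matrix (Fin n) (Fin n) ℂ, IsUnit S →
      ∀ Q, Q ∈ Du_dom n → Q ∈ Dv_dom n →
      (∀ k, Prod.fst Q k + Complex.I • Prod.snd Q k =
        S * (Prod.fst P k + Complex.I • Prod.snd P k) * S⁻¹) →
      u n Q + Complex.I • v n Q = S * (u n P + Complex.I • v n P) * S⁻¹) ∧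
    -- `f` is Fréchet differentiable at every point of its domain:
    (∀ n, ∀ P, P ∈ Du_dom n → P ∈ Dv_dom n →
      ∃ L : (Fin d → Matrix (Fin n) (Fin n) ℂ) →ₗ[ℂ] Matrix (Fin n) (Fin n) ℂ,
        ∀ ε > (0 : ℝ), ∃ δ > (0 : ℝ), ∀ Z1 Z2 : Fin d → Matrix (Fin n) (Fin n) ℂ,
          (∀ k, (Z1 k).IsHermitian) → (∀ k, (Z2 k).IsHermitian) →
          ¬(Z1 = 0 ∧ Z2 = 0) → cNorm Z1 Z2 < δ →
          opNorm ((u n (P + (Z1, Z2)) + Complex.I • v n (P + (Z1, Z2))) -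
              (u n P + Complex.I • v n P) -
              L (fun k => Z1 k + Complex.I • Z2 k)) / cNorm Z1 Z2 < ε) := by
  have hlev : ∀ n, ∀ P, P ∈ Du_dom n → P ∈ Dv_dom n → _ := fun n P hPu hPv =>
    level_deriv hd (u n) (v n) (Du n P) (Dv n P) P (hDuadd n P hPu) (hDusmul n P hPu)
      (hDuF n P hPu) (hDvadd n P hPv) (hDvsmul n P hPv) (hDvF n P hPv) (hCR n P hPu hPv)
  have hsum : ∀ n m, ∀ P, P ∈ Du_dom n → P ∈ Dv_dom n → ∀ Q, Q ∈ Du_dom m → Q ∈ Dv_dom m →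
      u (n + m) (dSumT (Prod.fst P) (Prod.fst Q), dSumT (Prod.snd P) (Prod.snd Q)) +
          Complex.I • v (n + m)
            (dSumT (Prod.fst P) (Prod.fst Q), dSumT (Prod.snd P) (Prod.snd Q)) =
        dSum (u n P + Complex.I • v n P) (u m Q + Complex.I • v m Q) := by
    intro n m P hPu hPv Q hQu hQv
    rw [husum n m P hPu Q hQu, hvsum n m P hPv Q hQv, dSum_add_smul]
  refine ⟨hsum, ?_, ?_⟩
  · intro n P hPu hPv S hS Q hQu hQv hPQ
    have hRu := hDu_domsum n n P hPu Q hQu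
    have hRv := hDv_domsum n n P hPv Q hQv
    have hRs := hsum n n P hPu hPv Q hQu hQv
    obtain ⟨L, hL⟩ := hlev _ _ hRu hRv
    have hcomm := comm_all L _ _ (comm_skew (u (n + n)) (v (n + n)) _ (hDu_domherm _ _ hRu).1
      (hDu_domherm _ _ hRu).2 L hL (by
        obtain ⟨ε1, hε1, H1⟩ := hDu_domopen _ _ hRu
        obtain ⟨ε2, hε2, H2⟩ := hDv_domopen _ _ hRv
        refine ⟨min ε1 ε2, lt_min hε1 hε2, fun U hU h1 h2 => ?_⟩
        have k1 := fun k => Matrix.isHermitian_mul_mul_conjTranspose U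
          ((hDu_domherm _ _ hRu).1 k)
        have k2 := fun k => Matrix.isHermitian_mul_mul_conjTranspose U
          ((hDu_domherm _ _ hRu).2 k)
        rw [huu _ _ hRu U hU (H1 _ k1 k2 (fun k => (h1 k).trans_le (min_le_left _ _))
            (fun k => (h2 k).trans_le (min_le_left _ _))),
          hvu _ _ hRv U hU (H2 _ k1 k2 (fun k => (h1 k).trans_le (min_le_right _ _))
            (fun k => (h2 k).trans_le (min_le_right _ _)))]
        simp only [mul_add, add_mul, Matrix.mul_smul, Matrix.smul_mul]))
      ((Matrix.fromBlocks 0 0 S 0).submatrix finSumFinEquiv.symm finSumFinEquiv.symm)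
    have hdet : IsUnit S.det := (Matrix.isUnit_iff_isUnit_det S).1 hS
    rw [hRs, low_comm] at hcomm
    have hz : (fun k => (Matrix.fromBlocks 0 0 S 0).submatrix finSumFinEquiv.symm
        finSumFinEquiv.symm * cT (dSumT P.1 Q.1) (dSumT P.2 Q.2) k -
        cT (dSumT P.1 Q.1) (dSumT P.2 Q.2) k * (Matrix.fromBlocks 0 0 S 0).submatrix
          finSumFinEquiv.symm finSumFinEquiv.symm) = 0 := by
      funext k
      have : cT (dSumT P.1 Q.1) (dSumT P.2 Q.2) k =
          dSum (P.1 k + Complex.I • P.2 k) (Q.1 k + Complex.I • Q.2 k) := dSum_add_smul _ _ _ _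
      rw [this, low_comm, hPQ k, Matrix.nonsing_inv_mul_cancel_right _ _ hdet, sub_self,
        Matrix.fromBlocks_zero]
      rfl
    rw [hz, map_zero] at hcomm
    have hfin : S * (u n P + Complex.I • v n P) = (u n Q + Complex.I • v n Q) * S := by
      rw [← sub_eq_zero]
      ext i j
      have := congrFun (congrFun hcomm (finSumFinEquiv (Sum.inr i))) (finSumFinEquiv (Sum.inl j))
      simpa only [Matrix.submatrix_apply, Equiv.symm_apply_apply, Matrix.fromBlocks_apply₂₁,
        Matrix.zero_apply] using this.symm
    rw [hfin, Matrix.mul_nonsing_inv_cancel_right _ _ hdet]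
  · intro n P hPu hPv
    obtain ⟨L, hL⟩ := hlev n P hPu hPv
    refine ⟨L, fun ε hε => ?_⟩
    obtain ⟨δ, hδ, H⟩ := hL (ε / 2) (by positivity)
    refine ⟨δ, hδ, fun Z1 Z2 h1 h2 hz hlt => ?_⟩
    have hpos : 0 < cNorm Z1 Z2 := by
      rw [cNorm_eq hd]; exact (pNorm_pos hz).trans_le (pNorm_le hd h1 h2)
    have := H (cT Z1 Z2) (by rw [← cNorm_eq hd]; exact hlt)
    rw [hRe_cT h1 h2, hIm_cT h1 h2, ← cNorm_eq hd] at this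
    rw [div_lt_iff₀ hpos]
    refine lt_of_le_of_lt this ?_
    exact mul_lt_mul_of_pos_right (half_lt_self hε) hpos
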